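/- arXiv:2403.09649 — 2 statements merged into one kernel-verified Lean document; each statement's English description precedes it below -/
import Mathlib

section
/- Let p ≥ 2 be a real number, let πₚ = 2π/(p·sin(π/p)), and set α = 2^p·ln(2/πₚ)/πₚ^p and β = −1/(p(p+1)). Then for every y ∈ (0, 1), writing x = arcsinₚ(y), one has exp(α·x^p) < y/x < exp(β·x^p). (This is the double inequality exp(α x^p) < sinₚ(x)/x < exp(β x^p) for x ∈ (0, πₚ/2).) -/
open Real

/-- The generalized inverse sine: `arcsinp p y = ∫₀^y (1 - t^p)^(-1/p) dt`. -/
noncomputable def arcsinp (p y : ℝ) : ℝ := ∫ t in (0:ℝ)..y, (1 - t ^ p) ^ (-1 / p)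

open MeasureTheory Set Filter Topology

/-- Cauchy's mean value theorem for a quotient of functions vanishing at the left endpoint. -/
theorem exists_div_eq_of_hasDerivAt {f g g' r : ℝ → ℝ} {a b : ℝ} (hab : a < b)
    (hf : ContinuousOn f (Icc a b)) (hg : ContinuousOn g (Icc a b)) (hfa : f a = 0) (hga : g a = 0)
    (hf' : ∀ x ∈ Ioo a b, HasDerivAt f (r x * g' x) x)
    (hg' : ∀ x ∈ Ioo a b, HasDerivAt g (g' x) x) (hpos : ∀ x ∈ Ioo a b, 0 < g' x) :
    0 < g b ∧ ∃ c ∈ Ioo a b, f b / g b = r c := by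
  have hgb : 0 < g b := by
    obtain ⟨c, hc, h⟩ := exists_hasDerivAt_eq_slope g g' hab hg hg'
    have := hpos c hc
    rw [h, hga, sub_zero] at this
    exact (div_pos_iff_of_pos_right (sub_pos.2 hab)).1 this
  refine ⟨hgb, ?_⟩
  obtain ⟨c, hc, h⟩ := exists_ratio_hasDerivAt_eq_ratio_slope f _ hab hf hf' g g' hg hg'
  refine ⟨c, hc, ?_⟩
  rw [hfa, hga, sub_zero, sub_zero, ← mul_assoc] at h
  have := mul_right_cancel₀ (hpos c hc).ne' h
  rw [div_eq_iff hgb.ne', ← this, mul_comm]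

/-- Monotone form of L'Hôpital's rule. -/
theorem strictMonoOn_div_of_hasDerivAt {f g g' r : ℝ → ℝ} {a b : ℝ}
    (hf : ContinuousOn f (Icc a b)) (hg : ContinuousOn g (Icc a b)) (hfa : f a = 0) (hga : g a = 0)
    (hf' : ∀ x ∈ Ioo a b, HasDerivAt f (r x * g' x) x)
    (hg' : ∀ x ∈ Ioo a b, HasDerivAt g (g' x) x) (hpos : ∀ x ∈ Ioo a b, 0 < g' x)
    (hr : StrictMonoOn r (Ioo a b)) :
    StrictMonoOn (fun x ↦ f x / g x) (Ioc a b) := by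
  intro x hx y hy hxy
  have hsub : Ioo a x ⊆ Ioo a b := Ioo_subset_Ioo_right hx.2
  have hsub' : Ioo x y ⊆ Ioo a b := Ioo_subset_Ioo hx.1.le hy.2
  obtain ⟨hgx, c, hc, h⟩ := exists_div_eq_of_hasDerivAt hx.1
    (hf.mono (Icc_subset_Icc_right hx.2)) (hg.mono (Icc_subset_Icc_right hx.2)) hfa hga
    (fun z hz ↦ hf' z (hsub hz)) (fun z hz ↦ hg' z (hsub hz)) (fun z hz ↦ hpos z (hsub hz))
  obtain ⟨hgy, d, hd, h'⟩ := exists_div_eq_of_hasDerivAt (f := fun z ↦ f z - f x)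
    (g := fun z ↦ g z - g x) (g' := g') (r := r) hxy
    ((hf.mono (Icc_subset_Icc hx.1.le hy.2)).sub continuousOn_const)
    ((hg.mono (Icc_subset_Icc hx.1.le hy.2)).sub continuousOn_const) (sub_self _) (sub_self _)
    (fun z hz ↦ (hf' z (hsub' hz)).sub_const _) (fun z hz ↦ (hg' z (hsub' hz)).sub_const _)
    (fun z hz ↦ hpos z (hsub' hz))
  have hcd : r c < r d := hr (hsub hc) (hsub' hd) (hc.2.trans hd.1)
  rw [← h, ← h', div_lt_div_iff₀ hgx hgy] at hcd
  change f x / g x < f y / g y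
  rw [div_lt_div_iff₀ hgx (by linarith)]
  linarith

section

variable {p y : ℝ}

theorem one_sub_rpow_pos (hp : 0 < p) (hy : y ∈ Ico (0 : ℝ) 1) : 0 < 1 - y ^ p :=
  sub_pos.2 (rpow_lt_one hy.1 hy.2 hp)

theorem intervalIntegrable_arcsinp (hp : 1 < p) :
    IntervalIntegrable (fun t : ℝ ↦ (1 - t ^ p) ^ (-1 / p)) volume 0 1 := by
  have hp0 : 0 < p := by linarith
  have h1 : -1 < -1 / p := by rw [lt_div_iff₀ hp0]; linarith
  have h2 : -1 / p ≤ 0 := div_nonpos_of_nonpos_of_nonneg (by norm_num) hp0.le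
  have h := ((intervalIntegral.intervalIntegrable_rpow' (a := 0) (b := 1) h1).comp_sub_left 1).symm
  rw [sub_zero, sub_self] at h
  refine h.mono_fun (Measurable.aestronglyMeasurable (by fun_prop)) ?_
  rw [uIoc_of_le zero_le_one, ← restrict_Ioo_eq_restrict_Ioc]
  refine (ae_restrict_iff' measurableSet_Ioo).2 (Eventually.of_forall fun t ht ↦ ?_)
  have h3 := one_sub_rpow_pos hp0 ⟨ht.1.le, ht.2⟩
  have h4 : t ^ p ≤ t := rpow_le_self_of_le_one ht.1.le ht.2.le hp.le
  change ‖_‖ ≤ ‖_‖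
  rw [norm_of_nonneg (rpow_nonneg h3.le _), norm_of_nonneg (rpow_nonneg (by linarith [ht.2]) _)]
  exact rpow_le_rpow_of_nonpos (by linarith [ht.2]) (by linarith) h2

theorem continuousOn_arcsinp (hp : 1 < p) : ContinuousOn (arcsinp p) (Icc 0 1) := by
  have := intervalIntegral.continuousOn_primitive_interval'
    (intervalIntegrable_arcsinp hp) (left_mem_uIcc)
  rwa [uIcc_of_le zero_le_one] at this

theorem hasDerivAt_arcsinp (hp : 1 < p) (hy : y ∈ Ico (0 : ℝ) 1) :
    HasDerivAt (arcsinp p) ((1 - y ^ p) ^ (-1 / p)) y := by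
  have hp0 : 0 < p := by linarith
  refine intervalIntegral.integral_hasDerivAt_right
    ((intervalIntegrable_arcsinp hp).mono_set ?_) ?_ ?_
  · rw [uIcc_of_le hy.1, uIcc_of_le zero_le_one]
    exact Icc_subset_Icc_right hy.2.le
  · exact (Measurable.stronglyMeasurable (by fun_prop)).stronglyMeasurableAtFilter
  · exact (continuousAt_const.sub (continuousAt_rpow_const _ _ (Or.inr hp0.le))).rpow_const
      (Or.inl (one_sub_rpow_pos hp0 hy).ne')

theorem arcsinp_zero : arcsinp p 0 = 0 := intervalIntegral.integral_same

theorem integral_rpow_mul_one_sub_rpow {u v : ℝ} (hu : 0 < u) (hv : 0 < v) :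
    ∫ x in (0 : ℝ)..1, x ^ (u - 1) * (1 - x) ^ (v - 1) =
      Real.Gamma u * Real.Gamma v / Real.Gamma (u + v) := by
  change _ = ProbabilityTheory.beta u v
  rw [ProbabilityTheory.beta_eq_betaIntegralReal u v hu hv, Complex.betaIntegral,
    ← Complex.ofReal_re (∫ x in (0 : ℝ)..1, _), ← intervalIntegral.integral_ofReal]
  congr 1
  refine intervalIntegral.integral_congr fun x hx ↦ ?_
  rw [uIcc_of_le zero_le_one] at hx
  simp only [Complex.ofReal_mul]
  rw [Complex.ofReal_cpow hx.1, Complex.ofReal_cpow (sub_nonneg.2 hx.2)]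
  push_cast
  rfl

theorem arcsinp_one (hp : 1 < p) : arcsinp p 1 = π / (p * sin (π / p)) := by
  have hp0 : 0 < p := by linarith
  have hp1 : 0 < 1 - 1 / p := by rw [sub_pos, div_lt_one hp0]; exact hp
  have hB := integral_rpow_mul_one_sub_rpow (u := 1 / p) (v := 1 - 1 / p) (by positivity) hp1
  rw [Real.Gamma_mul_Gamma_one_sub, add_sub_cancel, Real.Gamma_one, div_one, mul_one_div] at hB
  have hsub := integral_comp_rpow_Ioi_of_pos (p := p)
    (g := (Ioo (0 : ℝ) 1).indicator fun x ↦ x ^ (1 / p - 1) * (1 - x) ^ (1 - 1 / p - 1)) hp0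
  rw [setIntegral_indicator measurableSet_Ioo, inter_eq_right.2 Ioo_subset_Ioi_self,
    ← integral_Ioc_eq_integral_Ioo, ← intervalIntegral.integral_of_le zero_le_one, hB] at hsub
  have hcongr : ∀ x ∈ Ioi (0 : ℝ), (p * x ^ (p - 1)) •
      (Ioo (0 : ℝ) 1).indicator (fun x ↦ x ^ (1 / p - 1) * (1 - x) ^ (1 - 1 / p - 1)) (x ^ p) =
      (Ioo (0 : ℝ) 1).indicator (fun x ↦ p * (1 - x ^ p) ^ (-1 / p)) x := by
    intro x hx
    have hx : 0 < x := hx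
    by_cases h : x < 1
    · rw [indicator_of_mem (mem_Ioo.2 ⟨hx, h⟩),
        indicator_of_mem (mem_Ioo.2 ⟨rpow_pos_of_pos hx p, rpow_lt_one hx.le h hp0⟩),
        ← rpow_mul hx.le, smul_eq_mul, mul_assoc, ← mul_assoc (x ^ (p - 1)), ← rpow_add hx]
      have e1 : p - 1 + p * (1 / p - 1) = 0 := by field_simp; ring
      have e2 : 1 - 1 / p - 1 = -1 / p := by ring
      rw [e1, e2, rpow_zero, one_mul]
    · have h2 := one_le_rpow (not_lt.1 h) hp0.le
      rw [indicator_of_notMem (a := x) (fun h' ↦ h h'.2),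
        indicator_of_notMem (a := x ^ p) (fun h' ↦ h2.not_gt h'.2), smul_zero]
  rw [setIntegral_congr_fun measurableSet_Ioi hcongr, setIntegral_indicator measurableSet_Ioo,
    inter_eq_right.2 Ioo_subset_Ioi_self, ← integral_Ioc_eq_integral_Ioo,
    ← intervalIntegral.integral_of_le zero_le_one, intervalIntegral.integral_const_mul] at hsub
  change p * arcsinp p 1 = _ at hsub
  rw [mul_comm p (sin _), ← div_div, ← hsub, mul_div_cancel_left₀ _ hp0.ne']

theorem arcsinp_pos (hp : 1 < p) (hy : y ∈ Ioc (0 : ℝ) 1) : 0 < arcsinp p y := by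
  have hp0 : 0 < p := by linarith
  have hmem : ∀ x ∈ Ioo 0 y, x ∈ Ico (0 : ℝ) 1 := fun x hx ↦ ⟨hx.1.le, hx.2.trans_le hy.2⟩
  have hc : ContinuousOn (arcsinp p) (Icc 0 y) :=
    (continuousOn_arcsinp hp).mono (Icc_subset_Icc_right hy.2)
  exact (exists_div_eq_of_hasDerivAt (f := fun _ ↦ 0) (r := fun _ ↦ 0) hy.1 continuousOn_const
    hc rfl arcsinp_zero (fun x _ ↦ by simpa using hasDerivAt_const x (0 : ℝ))
    (fun x hx ↦ hasDerivAt_arcsinp hp (hmem x hx))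
    (fun x hx ↦ rpow_pos_of_pos (one_sub_rpow_pos hp0 (hmem x hx)) _)).1

/-- The generalized cosine as a function of `y = sinₚ x`. -/
noncomputable def cosOfSin (p y : ℝ) : ℝ := (1 - y ^ p) ^ (1 / p)

theorem cosOfSin_pos (hp : 0 < p) (hy : y ∈ Ico (0 : ℝ) 1) : 0 < cosOfSin p y :=
  rpow_pos_of_pos (one_sub_rpow_pos hp hy) _

theorem cosOfSin_rpow (hp : 0 < p) (hy : y ∈ Ico (0 : ℝ) 1) : cosOfSin p y ^ p = 1 - y ^ p := by
  rw [cosOfSin, ← rpow_mul (one_sub_rpow_pos hp hy).le, one_div_mul_cancel hp.ne', rpow_one]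

theorem hasDerivAt_arcsinp' (hp : 1 < p) (hy : y ∈ Ico (0 : ℝ) 1) :
    HasDerivAt (arcsinp p) (1 / cosOfSin p y) y := by
  have hp0 : 0 < p := by linarith
  convert hasDerivAt_arcsinp hp hy using 1
  rw [cosOfSin, neg_div, rpow_neg (one_sub_rpow_pos hp0 hy).le, one_div]

theorem continuous_cosOfSin (hp : 0 < p) : Continuous (cosOfSin p) :=
  (continuous_const.sub (continuous_id.rpow_const fun _ ↦ Or.inr hp.le)).rpow_const
    fun _ ↦ Or.inr (by positivity)

theorem hasDerivAt_cosOfSin (hp : 0 < p) (hy : y ∈ Ioo (0 : ℝ) 1) :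
    HasDerivAt (cosOfSin p) (-(y ^ (p - 1) * cosOfSin p y ^ (1 - p))) y := by
  have h1 := one_sub_rpow_pos hp ⟨hy.1.le, hy.2⟩
  have h := ((hasDerivAt_rpow_const (x := y) (p := p) (Or.inl hy.1.ne')).const_sub 1).rpow_const
    (p := 1 / p) (Or.inl h1.ne')
  refine h.congr_deriv ?_
  rw [cosOfSin, ← rpow_mul h1.le]
  have e : 1 / p * (1 - p) = 1 / p - 1 := by field_simp
  rw [e]
  field_simp

/-- The quotient `tanₚ x / x` as a function of `y = sinₚ x`. -/
noncomputable def tanDiv (p y : ℝ) : ℝ := y / cosOfSin p y / arcsinp p y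

theorem hasDerivAt_tan (hp : 1 < p) (hy : y ∈ Ioo (0 : ℝ) 1) :
    HasDerivAt (fun t ↦ t / cosOfSin p t) (1 / (1 - y ^ p) * (1 / cosOfSin p y)) y := by
  have hp0 : 0 < p := by linarith
  have hy' : y ∈ Ico (0 : ℝ) 1 := ⟨hy.1.le, hy.2⟩
  have hc := cosOfSin_pos hp0 hy'
  have h1 := one_sub_rpow_pos hp0 hy'
  refine ((hasDerivAt_id y).div (hasDerivAt_cosOfSin hp0 hy) hc.ne').congr_deriv ?_
  have e1 : cosOfSin p y ^ (1 - p) = cosOfSin p y / (1 - y ^ p) := by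
    rw [rpow_sub hc, rpow_one, cosOfSin_rpow hp0 hy']
  have e2 : y ^ (p - 1) = y ^ p / y := by rw [rpow_sub hy.1, rpow_one]
  have := hy.1.ne'
  simp only [id]
  rw [e1, e2]
  field_simp
  ring

theorem continuousOn_tan (hp : 1 < p) {b : ℝ} (hb : b < 1) :
    ContinuousOn (fun t ↦ t / cosOfSin p t) (Icc 0 b) :=
  continuousOn_id.div (continuous_cosOfSin (by linarith)).continuousOn
    fun _ hx ↦ (cosOfSin_pos (by linarith) ⟨hx.1, hx.2.trans_lt hb⟩).ne'

theorem strictMonoOn_tanDiv (hp : 1 < p) : StrictMonoOn (tanDiv p) (Ioo 0 1) := by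
  have hp0 : 0 < p := by linarith
  intro x hx y hy hxy
  have hmem : ∀ z ∈ Ioo 0 y, z ∈ Ioo (0 : ℝ) 1 := fun z hz ↦ ⟨hz.1, hz.2.trans hy.2⟩
  refine strictMonoOn_div_of_hasDerivAt (continuousOn_tan hp hy.2)
    ((continuousOn_arcsinp hp).mono (Icc_subset_Icc_right hy.2.le)) (zero_div _) arcsinp_zero
    (fun z hz ↦ hasDerivAt_tan hp (hmem z hz))
    (fun z hz ↦ hasDerivAt_arcsinp' hp (Ioo_subset_Ico_self (hmem z hz)))
    (fun z hz ↦ one_div_pos.2 (cosOfSin_pos hp0 (Ioo_subset_Ico_self (hmem z hz)))) ?_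
    ⟨hx.1, hxy.le⟩ ⟨hy.1, le_rfl⟩ hxy
  intro z hz w hw hzw
  have h1 := one_sub_rpow_pos hp0 (Ioo_subset_Ico_self (hmem w hw))
  exact one_div_lt_one_div_of_lt h1 (sub_lt_sub_left (rpow_lt_rpow hz.1.le hzw hp0) _)

theorem one_lt_tanDiv (hp : 1 < p) (hy : y ∈ Ioo (0 : ℝ) 1) : 1 < tanDiv p y := by
  have hp0 : 0 < p := by linarith
  have hmem : ∀ z ∈ Ioo 0 y, z ∈ Ioo (0 : ℝ) 1 := fun z hz ↦ ⟨hz.1, hz.2.trans hy.2⟩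
  obtain ⟨-, c, hc, h⟩ := exists_div_eq_of_hasDerivAt hy.1 (continuousOn_tan hp hy.2)
    ((continuousOn_arcsinp hp).mono (Icc_subset_Icc_right hy.2.le)) (zero_div _) arcsinp_zero
    (fun z hz ↦ hasDerivAt_tan hp (hmem z hz))
    (fun z hz ↦ hasDerivAt_arcsinp' hp (Ioo_subset_Ico_self (hmem z hz)))
    (fun z hz ↦ one_div_pos.2 (cosOfSin_pos hp0 (Ioo_subset_Ico_self (hmem z hz))))
  rw [tanDiv, h, lt_one_div one_pos (one_sub_rpow_pos hp0 (Ioo_subset_Ico_self (hmem c hc)))]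
  have := rpow_pos_of_pos hc.1 p
  linarith

theorem strictMonoOn_rpow_div_add (hp : 2 ≤ p) :
    StrictMonoOn (fun q : ℝ ↦ q ^ (p - 2) / (p + 1 / q)) (Ioi 0) := by
  intro a ha b hb hab
  have ha : 0 < a := ha
  have hb : 0 < b := hb
  have hp0 : 0 < p := by linarith
  have h1 : a ^ (p - 2) ≤ b ^ (p - 2) := rpow_le_rpow ha.le hab.le (by linarith)
  have h2 : 1 / b < 1 / a := one_div_lt_one_div_of_lt ha hab
  have h3 : 0 < 1 / b := by positivity
  exact div_lt_div₀' h1 (by linarith) (by positivity) (by positivity)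

theorem hasDerivAt_sub_cos_mul (hp : 1 < p) (hy : y ∈ Ioo (0 : ℝ) 1) :
    HasDerivAt (fun t ↦ t - cosOfSin p t * arcsinp p t)
      (y ^ (p - 1) * cosOfSin p y ^ (1 - p) * arcsinp p y) y := by
  have hp0 : 0 < p := by linarith
  have hy' := Ioo_subset_Ico_self hy
  have hc := cosOfSin_pos hp0 hy'
  refine ((hasDerivAt_id y).sub
    ((hasDerivAt_cosOfSin hp0 hy).mul (hasDerivAt_arcsinp' hp hy'))).congr_deriv ?_
  field_simp
  ring

theorem hasDerivAt_arcsinp_rpow (hp : 1 < p) (hy : y ∈ Ioo (0 : ℝ) 1) :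
    HasDerivAt (fun t ↦ arcsinp p t ^ p) (p * arcsinp p y ^ (p - 1) / cosOfSin p y) y := by
  refine ((hasDerivAt_arcsinp' hp (Ioo_subset_Ico_self hy)).rpow_const
    (Or.inl (arcsinp_pos hp (Ioo_subset_Ioc_self hy)).ne')).congr_deriv ?_
  ring

theorem strictMonoOn_sub_cos_mul_div_and_lt (hp : 2 ≤ p) :
    StrictMonoOn (fun t ↦ (t - cosOfSin p t * arcsinp p t) / (t * arcsinp p t ^ p)) (Ioc 0 1) ∧
    ∀ y ∈ Ioo (0 : ℝ) 1,
      1 / (p + 1) < (y - cosOfSin p y * arcsinp p y) / (y * arcsinp p y ^ p) := by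
  have hp0 : 0 < p := by linarith
  have hp1 : 1 < p := by linarith
  set A : ℝ → ℝ := fun t ↦ t - cosOfSin p t * arcsinp p t with hA
  set B : ℝ → ℝ := fun t ↦ t * arcsinp p t ^ p with hB
  set B' : ℝ → ℝ := fun t ↦ arcsinp p t ^ p + t * (p * arcsinp p t ^ (p - 1) / cosOfSin p t)
    with hB'
  set r : ℝ → ℝ := fun t ↦ tanDiv p t ^ (p - 2) / (p + 1 / tanDiv p t) with hr
  have hcont := continuousOn_arcsinp hp1
  have hAc : ContinuousOn A (Icc 0 1) :=
    continuousOn_id.sub ((continuous_cosOfSin hp0).continuousOn.mul hcont)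
  have hBc : ContinuousOn B (Icc 0 1) :=
    continuousOn_id.mul (hcont.rpow_const fun _ _ ↦ Or.inr hp0.le)
  have hA0 : A 0 = 0 := by simp [hA, arcsinp_zero]
  have hB0 : B 0 = 0 := by simp [hB]
  have hBd : ∀ t ∈ Ioo (0 : ℝ) 1, HasDerivAt B (B' t) t := fun t ht ↦
    ((hasDerivAt_id t).mul (hasDerivAt_arcsinp_rpow hp1 ht)).congr_deriv (by simp [hB'])
  have hBpos : ∀ t ∈ Ioo (0 : ℝ) 1, 0 < B' t := by
    intro t ht
    have hx := arcsinp_pos hp1 (Ioo_subset_Ioc_self ht)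
    have hc := cosOfSin_pos hp0 (Ioo_subset_Ico_self ht)
    have := ht.1
    positivity
  have hAd : ∀ t ∈ Ioo (0 : ℝ) 1, HasDerivAt A (r t * B' t) t := by
    intro t ht
    have hx := arcsinp_pos hp1 (Ioo_subset_Ioc_self ht)
    have hc := cosOfSin_pos hp0 (Ioo_subset_Ico_self ht)
    have ht0 := ht.1
    refine (hasDerivAt_sub_cos_mul hp1 ht).congr_deriv ?_
    simp only [hr, hB', tanDiv]
    rw [div_rpow (by positivity) hx.le, div_rpow ht0.le hc.le]
    simp only [rpow_sub ht0, rpow_sub hc, rpow_sub hx, rpow_one, rpow_two]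
    have h1 := rpow_pos_of_pos hx p
    have h2 := rpow_pos_of_pos hc p
    have h3 := rpow_pos_of_pos ht0 p
    field_simp
    ring
  have hrmono : StrictMonoOn r (Ioo 0 1) :=
    (strictMonoOn_rpow_div_add hp).comp (strictMonoOn_tanDiv hp1)
      fun t ht ↦ one_pos.trans (one_lt_tanDiv hp1 ht)
  refine ⟨strictMonoOn_div_of_hasDerivAt hAc hBc hA0 hB0 hAd hBd hBpos hrmono, fun y hy ↦ ?_⟩
  have hmem : ∀ z ∈ Ioo 0 y, z ∈ Ioo (0 : ℝ) 1 := fun z hz ↦ ⟨hz.1, hz.2.trans hy.2⟩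
  have hsub : Icc 0 y ⊆ Icc 0 1 := Icc_subset_Icc_right hy.2.le
  obtain ⟨-, c, hc, h⟩ := exists_div_eq_of_hasDerivAt hy.1 (hAc.mono hsub) (hBc.mono hsub) hA0 hB0
    (fun z hz ↦ hAd z (hmem z hz)) (fun z hz ↦ hBd z (hmem z hz))
    (fun z hz ↦ hBpos z (hmem z hz))
  change _ < A y / B y
  rw [h]
  have hq := one_lt_tanDiv hp1 (hmem c hc)
  simpa [hr] using strictMonoOn_rpow_div_add hp (mem_Ioi.2 one_pos) (mem_Ioi.2 (one_pos.trans hq)) hq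

theorem continuousOn_log_arcsinp_div (hp : 1 < p) :
    ContinuousOn (fun t ↦ log (arcsinp p t / t)) (Icc 0 1) := by
  intro y hy
  rcases hy.1.eq_or_lt with rfl | hy0
  · rw [← continuousWithinAt_sdiff_self]
    have h := (hasDerivAt_arcsinp hp (left_mem_Ico.2 one_pos)).tendsto_slope
    rw [zero_rpow (by linarith), sub_zero, one_rpow] at h
    have h' := h.log one_ne_zero
    have hsub : Icc (0 : ℝ) 1 \ {0} ⊆ {0}ᶜ := fun _ hx ↦ hx.2
    have h2 := h'.mono_left (nhdsWithin_mono _ hsub)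
    simpa [ContinuousWithinAt, slope_fun_def_field, arcsinp_zero] using h2
  · exact ((continuousOn_arcsinp hp y hy).div continuousWithinAt_id hy0.ne').log
      (div_pos (arcsinp_pos hp ⟨hy0, hy.2⟩) hy0).ne'

theorem strictMonoOn_log_arcsinp_div_and_lt (hp : 2 ≤ p) :
    StrictMonoOn (fun t ↦ log (arcsinp p t / t) / arcsinp p t ^ p) (Ioc 0 1) ∧
    ∀ y ∈ Ioo (0 : ℝ) 1, 1 / (p * (p + 1)) < log (arcsinp p y / y) / arcsinp p y ^ p := by
  have hp0 : 0 < p := by linarith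
  have hp1 : 1 < p := by linarith
  obtain ⟨hmono, hlow⟩ := strictMonoOn_sub_cos_mul_div_and_lt hp
  have hf := continuousOn_log_arcsinp_div hp1
  have hg : ContinuousOn (fun t ↦ arcsinp p t ^ p) (Icc 0 1) :=
    (continuousOn_arcsinp hp1).rpow_const fun _ _ ↦ Or.inr hp0.le
  have hf0 : log (arcsinp p 0 / 0) = 0 := by simp
  have hg0 : arcsinp p 0 ^ p = 0 := by rw [arcsinp_zero, zero_rpow hp0.ne']
  have hpos : ∀ t ∈ Ioo (0 : ℝ) 1, 0 < p * arcsinp p t ^ (p - 1) / cosOfSin p t := by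
    intro t ht
    have hx := arcsinp_pos hp1 (Ioo_subset_Ioc_self ht)
    have hc := cosOfSin_pos hp0 (Ioo_subset_Ico_self ht)
    positivity
  have hfd : ∀ t ∈ Ioo (0 : ℝ) 1, HasDerivAt (fun t ↦ log (arcsinp p t / t))
      ((t - cosOfSin p t * arcsinp p t) / (t * arcsinp p t ^ p) / p *
        (p * arcsinp p t ^ (p - 1) / cosOfSin p t)) t := by
    intro t ht
    have hx := arcsinp_pos hp1 (Ioo_subset_Ioc_self ht)
    have hc := cosOfSin_pos hp0 (Ioo_subset_Ico_self ht)
    have ht0 := ht.1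
    refine (((hasDerivAt_arcsinp' hp1 (Ioo_subset_Ico_self ht)).div (hasDerivAt_id t)
      ht0.ne').log (div_pos hx ht0).ne').congr_deriv ?_
    have h1 := rpow_pos_of_pos hx p
    rw [rpow_sub hx, rpow_one]
    simp only [id, Pi.div_apply]
    field_simp
  have hgd := fun t (ht : t ∈ Ioo (0 : ℝ) 1) ↦ hasDerivAt_arcsinp_rpow hp1 ht
  refine ⟨strictMonoOn_div_of_hasDerivAt hf hg hf0 hg0 hfd hgd hpos
    fun a ha b hb hab ↦ div_lt_div_of_pos_right
      (hmono (Ioo_subset_Ioc_self ha) (Ioo_subset_Ioc_self hb) hab) hp0, fun y hy ↦ ?_⟩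
  have hmem : ∀ z ∈ Ioo 0 y, z ∈ Ioo (0 : ℝ) 1 := fun z hz ↦ ⟨hz.1, hz.2.trans hy.2⟩
  have hsub : Icc 0 y ⊆ Icc 0 1 := Icc_subset_Icc_right hy.2.le
  obtain ⟨-, c, hc, h⟩ := exists_div_eq_of_hasDerivAt hy.1 (hf.mono hsub) (hg.mono hsub) hf0 hg0
    (fun z hz ↦ hfd z (hmem z hz)) (fun z hz ↦ hgd z (hmem z hz))
    (fun z hz ↦ hpos z (hmem z hz))
  rw [h, mul_comm, ← div_div]
  exact div_lt_div_of_pos_right (hlow c (hmem c hc)) hp0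

end

/-- For `p ≥ 2`, `exp(α x^p) < sinₚ(x)/x < exp(β x^p)` on `(0, πₚ/2)`, where
`α = 2^p ln(2/πₚ)/πₚ^p` and `β = −1/(p(p+1))`, stated via `y = sinₚ x`, `x = arcsinₚ y`. -/
theorem exp_bounds_sinp_div (p : ℝ) (hp : 2 ≤ p) (pip α β : ℝ)
    (hpip : pip = 2 * Real.pi / (p * Real.sin (Real.pi / p)))
    (hα : α = 2 ^ p * Real.log (2 / pip) / pip ^ p)
    (hβ : β = -1 / (p * (p + 1))) :
    ∀ y ∈ Set.Ioo (0:ℝ) 1,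
      Real.exp (α * arcsinp p y ^ p) < y / arcsinp p y ∧
      y / arcsinp p y < Real.exp (β * arcsinp p y ^ p) := by
  intro y hy
  have hp1 : 1 < p := by linarith
  obtain ⟨hmono, hlow⟩ := strictMonoOn_log_arcsinp_div_and_lt hp
  have hx := arcsinp_pos hp1 (Ioo_subset_Ioc_self hy)
  have hxp := rpow_pos_of_pos hx p
  have hyx : 0 < y / arcsinp p y := div_pos hy.1 hx
  have h1 := arcsinp_pos hp1 (right_mem_Ioc.2 one_pos)
  have hpip' : pip = 2 * arcsinp p 1 := by rw [hpip, arcsinp_one hp1, mul_div_assoc]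
  have hα' : α = -(log (arcsinp p 1 / 1) / arcsinp p 1 ^ p) := by
    have h2 := rpow_pos_of_pos (zero_lt_two (α := ℝ)) p
    have h3 := rpow_pos_of_pos h1 p
    have h4 : 2 / (2 * arcsinp p 1) = (arcsinp p 1 / 1)⁻¹ := by field_simp
    rw [hα, hpip', h4, log_inv, mul_rpow zero_le_two h1.le]
    field_simp
  have hlog : log (y / arcsinp p y) = -log (arcsinp p y / y) := by rw [← log_inv, inv_div]
  rw [← lt_log_iff_exp_lt hyx, ← log_lt_iff_lt_exp hyx, hlog, hα', hβ]
  constructor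
  · have := hmono (Ioo_subset_Ioc_self hy) (right_mem_Ioc.2 one_pos) hy.2
    simp only at this
    rw [div_lt_iff₀ hxp] at this
    linarith
  · have := hlow y hy
    rw [lt_div_iff₀ hxp] at this
    rw [neg_div, neg_mul]
    exact neg_lt_neg this
end

section
/- Let p ≥ 2 be a real number, fix y₀ ∈ (0, 1), and set b = arcsinₚ(y₀), α₂ = ln(b·(1 − y₀^p)^(1/p)/y₀)/b^p and β₂ = −1/(p+1). Then for every y ∈ (0, y₀), writing x = arcsinₚ(y), one has exp(α₂·x^p) < x·(1 − y^p)^(1/p)/y < exp(β₂·x^p). (This is the double inequality exp(α₂ x^p) < x/tanₚ(x) < exp(β₂ x^p) for x ∈ (0, b), b < πₚ/2, with α₂ = ln(b/tanₚ b)/b^p.) -/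
open Real

open Set Filter Topology

/-- A monotone form of l'Hôpital's rule on `[0, ∞)`, together with the mean value form of the
quotient. -/
lemma strictMonoOn_div_of_hasDerivAt_s5 {f g g' ρ : ℝ → ℝ}
    (hf : ContinuousOn f (Ici 0)) (hg : ContinuousOn g (Ici 0)) (hf0 : f 0 = 0) (hg0 : g 0 = 0)
    (hf' : ∀ t, 0 < t → HasDerivAt f (ρ t * g' t) t) (hg' : ∀ t, 0 < t → HasDerivAt g (g' t) t)
    (hpos : ∀ t, 0 < t → 0 < g' t) (hρ : StrictMonoOn ρ (Ioi 0)) :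
    (∀ t, 0 < t → 0 < g t) ∧ StrictMonoOn (fun t => f t / g t) (Ioi 0) ∧
      ∀ t, 0 < t → ∃ c ∈ Ioo 0 t, f t / g t = ρ c := by
  have hmono : StrictMonoOn g (Ici 0) := by
    refine strictMonoOn_of_deriv_pos (convex_Ici 0) hg fun t ht => ?_
    rw [interior_Ici] at ht
    rw [(hg' t ht).deriv]
    exact hpos t ht
  have hgpos : ∀ t, 0 < t → 0 < g t := fun t ht => by
    simpa [hg0] using hmono self_mem_Ici ht.le ht
  have key : ∀ s t, 0 ≤ s → s < t → ∃ c ∈ Ioo s t, f t - f s = ρ c * (g t - g s) := by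
    intro s t hs hst
    have hsub : Icc s t ⊆ Ici 0 := fun z hz => hs.trans hz.1
    obtain ⟨c, hc, h⟩ := exists_ratio_hasDerivAt_eq_ratio_slope f (fun t => ρ t * g' t) hst
      (hf.mono hsub) (fun z hz => hf' z (hs.trans_lt hz.1)) g g' (hg.mono hsub)
      (fun z hz => hg' z (hs.trans_lt hz.1))
    refine ⟨c, hc, ?_⟩
    have hc' := hpos c (hs.trans_lt hc.1)
    apply mul_right_cancel₀ hc'.ne'
    linear_combination -h
  refine ⟨hgpos, fun s hs t ht hst => ?_, fun t ht => ?_⟩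
  · rw [mem_Ioi] at hs ht
    obtain ⟨c₁, hc₁, h₁⟩ := key 0 s le_rfl hs
    obtain ⟨c₂, hc₂, h₂⟩ := key s t hs.le hst
    rw [hf0, hg0, sub_zero, sub_zero] at h₁
    have hlt : ρ c₁ < ρ c₂ := hρ hc₁.1 (hs.trans hc₂.1) (hc₁.2.trans hc₂.1)
    have hgst : 0 < g t - g s := sub_pos.2 (hmono hs.le ht.le hst)
    have hgs := hgpos s hs
    have hgt := hgpos t ht
    change f s / g s < f t / g t
    rw [h₁, mul_div_cancel_right₀ _ hgs.ne', lt_div_iff₀ hgt]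
    nlinarith [mul_pos (sub_pos.2 hlt) hgst]
  · obtain ⟨c, hc, h⟩ := key 0 t le_rfl ht
    rw [hf0, hg0, sub_zero, sub_zero] at h
    exact ⟨c, hc, by rw [h, mul_div_cancel_right₀ _ (hgpos t ht).ne']⟩

/-- The generalized inverse tangent `∫₀^t (1 + |s|^p)⁻¹ ds`. -/
noncomputable def arctanp (p t : ℝ) : ℝ := ∫ s in (0:ℝ)..t, (1 + |s| ^ p)⁻¹

lemma continuous_inv_one_add_abs_rpow {p : ℝ} (hp : 0 ≤ p) :
    Continuous fun s : ℝ => (1 + |s| ^ p)⁻¹ := by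
  refine Continuous.inv₀ ?_ fun s => by positivity
  exact continuous_const.add (continuous_abs.rpow_const fun _ => Or.inr hp)

lemma hasDerivAt_arctanp {p : ℝ} (hp : 0 ≤ p) (t : ℝ) :
    HasDerivAt (arctanp p) (1 + |t| ^ p)⁻¹ t :=
  (continuous_inv_one_add_abs_rpow hp).integral_hasStrictDerivAt 0 t |>.hasDerivAt

lemma continuous_arctanp {p : ℝ} (hp : 0 ≤ p) : Continuous (arctanp p) :=
  continuous_iff_continuousAt.2 fun t => (hasDerivAt_arctanp hp t).continuousAt

lemma hasDerivAt_arctanp_of_pos {p : ℝ} (hp : 0 ≤ p) {t : ℝ} (ht : 0 < t) :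
    HasDerivAt (arctanp p) (1 + t ^ p)⁻¹ t := by
  simpa [abs_of_pos ht] using hasDerivAt_arctanp hp t

@[simp] lemma arctanp_zero (p : ℝ) : arctanp p 0 = 0 := by simp [arctanp]

lemma strictMonoOn_one_add_rpow {p : ℝ} (hp : 0 < p) :
    StrictMonoOn (fun t : ℝ => 1 + t ^ p) (Ioi 0) := fun s hs t _ hst => by
  have := rpow_lt_rpow (le_of_lt hs) hst hp
  simpa using this

lemma div_arctanp_properties {p : ℝ} (hp : 0 < p) :
    (∀ t, 0 < t → 0 < arctanp p t) ∧ StrictMonoOn (fun t => t / arctanp p t) (Ioi 0) ∧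
      ∀ t, 0 < t → ∃ c ∈ Ioo 0 t, t / arctanp p t = 1 + c ^ p := by
  refine strictMonoOn_div_of_hasDerivAt_s5 (f := fun t => t) (g' := fun t => (1 + t ^ p)⁻¹)
    (ρ := fun t => 1 + t ^ p)
    continuousOn_id (continuous_arctanp hp.le).continuousOn rfl (arctanp_zero p)
    (fun t ht => ?_) (fun t ht => hasDerivAt_arctanp_of_pos hp.le ht) (fun t ht => by positivity)
    (strictMonoOn_one_add_rpow hp)
  rw [mul_inv_cancel₀ (by positivity)]
  exact hasDerivAt_id' t

lemma arctanp_pos {p : ℝ} (hp : 0 < p) {t : ℝ} (ht : 0 < t) : 0 < arctanp p t :=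
  (div_arctanp_properties hp).1 t ht

lemma one_lt_div_arctanp {p : ℝ} (hp : 0 < p) {t : ℝ} (ht : 0 < t) : 1 < t / arctanp p t := by
  obtain ⟨c, hc, h⟩ := (div_arctanp_properties hp).2.2 t ht
  have := rpow_pos_of_pos hc.1 p
  linarith

lemma div_arctanp_lt {p : ℝ} (hp : 0 < p) {t : ℝ} (ht : 0 < t) :
    t / arctanp p t < 1 + t ^ p := by
  obtain ⟨c, hc, h⟩ := (div_arctanp_properties hp).2.2 t ht
  have := rpow_lt_rpow hc.1.le hc.2 hp
  linarith

lemma strictMonoOn_ratio_of_derivs {p : ℝ} (hp : 2 ≤ p) :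
    StrictMonoOn (fun t => p / ((t / arctanp p t) ^ (1 - p) +
      p * (t / arctanp p t) ^ (2 - p) * (1 + t ^ p)⁻¹)) (Ioi 0) := by
  intro s hs t ht hst
  have hp0 : 0 < p := by linarith
  rw [mem_Ioi] at hs ht
  have hu := (div_arctanp_properties hp0).2.1 hs ht hst
  have hus := one_lt_div_arctanp hp0 hs
  have hut := one_lt_div_arctanp hp0 ht
  dsimp only at hu ⊢
  set u := s / arctanp p s
  set v := t / arctanp p t
  have hu0 : 0 < u := by linarith
  have hv0 : 0 < v := by linarith
  have h1 : v ^ (1 - p) < u ^ (1 - p) := rpow_lt_rpow_of_neg hu0 hu (by linarith)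
  have h2 : v ^ (2 - p) ≤ u ^ (2 - p) := rpow_le_rpow_of_nonpos hu0 hu.le (by linarith)
  have h3 : (1 + t ^ p)⁻¹ ≤ (1 + s ^ p)⁻¹ :=
    inv_anti₀ (by positivity) (strictMonoOn_one_add_rpow hp0 hs ht hst).le
  have h4 : p * v ^ (2 - p) * (1 + t ^ p)⁻¹ ≤ p * u ^ (2 - p) * (1 + s ^ p)⁻¹ := by gcongr
  exact div_lt_div_of_pos_left hp0 (by positivity) (by linarith)

lemma lt_ratio_of_derivs {p : ℝ} (hp : 2 ≤ p) {t : ℝ} (ht : 0 < t) :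
    p / (p + 1) < p / ((t / arctanp p t) ^ (1 - p) +
      p * (t / arctanp p t) ^ (2 - p) * (1 + t ^ p)⁻¹) := by
  have hp0 : 0 < p := by linarith
  have hut := one_lt_div_arctanp hp0 ht
  set v := t / arctanp p t
  have hv0 : 0 < v := by linarith
  have h1 : v ^ (1 - p) < 1 := rpow_lt_one_of_one_lt_of_neg hut (by linarith)
  have h2 : v ^ (2 - p) ≤ 1 := rpow_le_one_of_one_le_of_nonpos hut.le (by linarith)
  have h3 : (1 + t ^ p)⁻¹ ≤ 1 := inv_le_one_of_one_le₀ (by linarith [rpow_pos_of_pos ht p])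
  have h4 : p * v ^ (2 - p) * (1 + t ^ p)⁻¹ ≤ p * 1 * 1 := by gcongr
  exact div_lt_div_of_pos_left hp0 (by positivity) (by linarith)

lemma derivative_quotient_properties {p : ℝ} (hp : 2 ≤ p) :
    StrictMonoOn (fun t => ((1 + t ^ p) * arctanp p t - t) / (t * arctanp p t ^ p)) (Ioi 0) ∧
      ∀ t, 0 < t → p / (p + 1) < ((1 + t ^ p) * arctanp p t - t) / (t * arctanp p t ^ p) := by
  have hp0 : 0 < p := by linarith
  have hA := continuous_arctanp hp0.le
  have hid : Continuous fun t : ℝ => t ^ p := continuous_rpow_const hp0.le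
  have hAp : Continuous fun t : ℝ => arctanp p t ^ p := hA.rpow_const fun _ => Or.inr hp0.le
  obtain ⟨-, h1, h2⟩ := strictMonoOn_div_of_hasDerivAt_s5
    (f := fun t => (1 + t ^ p) * arctanp p t - t) (g := fun t => t * arctanp p t ^ p)
    (g' := fun t => arctanp p t ^ p + t * ((1 + t ^ p)⁻¹ * p * arctanp p t ^ (p - 1)))
    (((continuous_const.add hid).mul hA).sub continuous_id).continuousOn
    (continuous_id.mul hAp).continuousOn (by simp) (by simp)
    (fun t ht => by
      have hd := hasDerivAt_arctanp_of_pos hp0.le ht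
      have h := ((((hasDerivAt_rpow_const (p := p) (Or.inl ht.ne')).const_add 1).mul hd).sub
        (hasDerivAt_id' t))
      refine h.congr_deriv (Eq.symm ?_)
      have ha := arctanp_pos hp0 ht
      have e1 : (1 + t ^ p) ≠ 0 := by positivity
      rw [mul_inv_cancel₀ e1, div_rpow ht.le ha.le, div_rpow ht.le ha.le]
      have e2 : arctanp p t ^ (1 - p) = arctanp p t / arctanp p t ^ p := by
        rw [rpow_sub ha, rpow_one]
      have e3 : arctanp p t ^ (2 - p) = arctanp p t ^ 2 / arctanp p t ^ p := by
        rw [rpow_sub ha, rpow_two]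
      have e4 : arctanp p t ^ (p - 1) = arctanp p t ^ p / arctanp p t := by
        rw [rpow_sub ha, rpow_one]
      have e5 : t ^ (1 - p) = t / t ^ p := by rw [rpow_sub ht, rpow_one]
      have e6 : t ^ (2 - p) = t ^ 2 / t ^ p := by rw [rpow_sub ht, rpow_two]
      have e7 : t ^ (p - 1) = t ^ p / t := by rw [rpow_sub ht, rpow_one]
      rw [e2, e3, e4, e5, e6, e7]
      have e8 : 0 < t ^ p := by positivity
      have e9 : 0 < arctanp p t ^ p := by positivity
      generalize arctanp p t ^ p = B at *
      generalize arctanp p t = a at *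
      generalize t ^ p = T at *
      field_simp
      ring)
    (fun t ht => by
      have ha := arctanp_pos hp0 ht
      have h := (hasDerivAt_id' t).mul
        ((hasDerivAt_arctanp_of_pos hp0.le ht).rpow_const (p := p) (Or.inl ha.ne'))
      rw [one_mul] at h
      exact h)
    (fun t ht => by
      have ha := arctanp_pos hp0 ht
      positivity)
    (strictMonoOn_ratio_of_derivs hp)
  refine ⟨h1, fun t ht => ?_⟩
  obtain ⟨c, hc, h⟩ := h2 t ht
  exact (lt_ratio_of_derivs hp hc.1).trans_eq h.symm

lemma continuousOn_log_div_arctanp {p : ℝ} (hp : 0 < p) :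
    ContinuousOn (fun t => log (t / arctanp p t)) (Ici 0) := by
  intro t ht
  rcases eq_or_lt_of_le (mem_Ici.1 ht) with rfl | ht
  · have h0 : Tendsto (fun t : ℝ => t ^ p) (𝓝[≥] 0) (𝓝 0) := by
      have := (continuous_rpow_const (q := p) hp.le).tendsto 0
      rw [zero_rpow hp.ne'] at this
      exact this.mono_left nhdsWithin_le_nhds
    rw [ContinuousWithinAt, arctanp_zero, div_zero, log_zero]
    refine tendsto_of_tendsto_of_tendsto_of_le_of_le' tendsto_const_nhds h0 ?_ ?_
    · filter_upwards [self_mem_nhdsWithin] with s hs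
      rcases eq_or_lt_of_le (mem_Ici.1 hs) with rfl | hs
      · simp
      · exact (log_pos (one_lt_div_arctanp hp hs)).le
    · filter_upwards [self_mem_nhdsWithin] with s hs
      rcases eq_or_lt_of_le (mem_Ici.1 hs) with rfl | hs
      · simp [zero_rpow hp.ne']
      · have h1 := one_lt_div_arctanp hp hs
        have h2 := div_arctanp_lt hp hs
        have h3 := log_le_sub_one_of_pos (zero_lt_one.trans h1)
        linarith
  · have ha := arctanp_pos hp ht
    exact ((continuousAt_id.div (continuous_arctanp hp.le).continuousAt ha.ne').log
      (div_pos ht ha).ne').continuousWithinAt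

lemma log_div_arctanp_properties {p : ℝ} (hp : 2 ≤ p) :
    StrictMonoOn (fun t => log (t / arctanp p t) / arctanp p t ^ p) (Ioi 0) ∧
      ∀ t, 0 < t → 1 / (p + 1) < log (t / arctanp p t) / arctanp p t ^ p := by
  have hp0 : 0 < p := by linarith
  have hA := continuous_arctanp hp0.le
  have hAp : Continuous fun t : ℝ => arctanp p t ^ p := hA.rpow_const fun _ => Or.inr hp0.le
  obtain ⟨hN, hN'⟩ := derivative_quotient_properties hp
  obtain ⟨-, h1, h2⟩ := strictMonoOn_div_of_hasDerivAt_s5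
    (f := fun t => log (t / arctanp p t)) (g := fun t => arctanp p t ^ p)
    (g' := fun t => (1 + t ^ p)⁻¹ * p * arctanp p t ^ (p - 1))
    (ρ := fun t => ((1 + t ^ p) * arctanp p t - t) / (t * arctanp p t ^ p) / p)
    (continuousOn_log_div_arctanp hp0) hAp.continuousOn (by simp) (by simp [hp0.ne'])
    (fun t ht => by
      have ha := arctanp_pos hp0 ht
      have h := ((hasDerivAt_id' t).div (hasDerivAt_arctanp_of_pos hp0.le ht) ha.ne').log
        (div_pos ht ha).ne'
      refine h.congr_deriv (Eq.symm ?_)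
      have e1 : 0 < t ^ p := by positivity
      have e2 : 0 < arctanp p t ^ p := by positivity
      rw [rpow_sub ha, rpow_one, Pi.div_apply]
      field_simp)
    (fun t ht => (hasDerivAt_arctanp_of_pos hp0.le ht).rpow_const
      (Or.inl (arctanp_pos hp0 ht).ne'))
    (fun t ht => by
      have ha := arctanp_pos hp0 ht
      positivity)
    (fun s hs t ht hst => div_lt_div_of_pos_right (hN hs ht hst) hp0)
  refine ⟨h1, fun t ht => ?_⟩
  obtain ⟨c, hc, h⟩ := h2 t ht
  rw [h, lt_div_iff₀ hp0]
  exact (by ring : 1 / (p + 1) * p = p / (p + 1)).trans_lt (hN' c hc.1)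

lemma hasDerivAt_mul_one_sub_rpow {p y : ℝ} (hp : 1 ≤ p) (hy0 : 0 ≤ y) (hy : 0 < 1 - y ^ p) :
    HasDerivAt (fun y : ℝ => y * (1 - y ^ p) ^ (-1 / p)) ((1 - y ^ p) ^ (-1 / p - 1)) y := by
  have hp0 : 0 < p := by linarith
  have h := (hasDerivAt_id' y).mul
    (((hasDerivAt_rpow_const (x := y) (p := p) (Or.inr hp)).const_sub 1).rpow_const
      (p := -1 / p) (Or.inl hy.ne'))
  refine h.congr_deriv (Eq.symm ?_)
  have e : y * y ^ (p - 1) = y ^ p := by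
    rcases eq_or_lt_of_le hy0 with rfl | h
    · simp [hp0.ne']
    · rw [rpow_sub h, rpow_one]
      field_simp
  have e2 : (1 - y ^ p) ^ (-1 / p) = (1 - y ^ p) ^ (-1 / p - 1) * (1 - y ^ p) := by
    rw [rpow_sub hy, rpow_one]
    field_simp
  have e3 : -(p * y ^ (p - 1)) * (-1 / p) = y ^ (p - 1) := by field_simp
  rw [e3, e2]
  linear_combination (-(1 - y ^ p) ^ (-1 / p - 1)) * e

lemma arcsinp_eq_arctanp {p y : ℝ} (hp : 1 ≤ p) (hy0 : 0 ≤ y) (hy1 : y < 1) :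
    arcsinp p y = arctanp p (y * (1 - y ^ p) ^ (-1 / p)) := by
  have hp0 : 0 < p := by linarith
  have hz : ∀ z ∈ uIcc 0 y, 0 ≤ z ∧ 0 < 1 - z ^ p := by
    intro z hz
    rw [uIcc_of_le hy0] at hz
    exact ⟨hz.1, sub_pos.2 (rpow_lt_one hz.1 (hz.2.trans_lt hy1) hp0)⟩
  have hcont : ContinuousOn (fun z : ℝ => (1 - z ^ p) ^ (-1 / p - 1)) (uIcc 0 y) :=
    ContinuousOn.rpow_const
      (continuous_const.sub (continuous_rpow_const hp0.le)).continuousOn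
      fun z h => Or.inl (hz z h).2.ne'
  have h := intervalIntegral.integral_comp_mul_deriv
    (fun z h => hasDerivAt_mul_one_sub_rpow hp (hz z h).1 (hz z h).2) hcont
    (continuous_inv_one_add_abs_rpow hp0.le)
  rw [zero_mul] at h
  rw [arctanp, ← h, arcsinp]
  refine intervalIntegral.integral_congr fun z h => ?_
  obtain ⟨h0, h1⟩ := hz z h
  have e1 : |z * (1 - z ^ p) ^ (-1 / p)| ^ p = z ^ p / (1 - z ^ p) := by
    rw [abs_of_nonneg (by positivity), mul_rpow h0 (by positivity), ← rpow_mul h1.le,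
      div_mul_cancel₀ _ hp0.ne', rpow_neg_one, div_eq_mul_inv]
  simp only [Function.comp_apply]
  rw [e1, rpow_sub h1, rpow_one]
  field_simp
  ring

/-- For `p ≥ 2`, `exp(α₂ x^p) < x/tanₚ x < exp(β₂ x^p)` on `(0, b)` with `b < πₚ/2`,
`α₂ = ln(b/tanₚ b)/b^p`, `β₂ = −1/(p+1)`, stated via `y = sinₚ x`, `x = arcsinₚ y`. -/
theorem exp_bounds_div_tanp (p : ℝ) (hp : 2 ≤ p) (y₀ : ℝ) (hy₀ : y₀ ∈ Set.Ioo (0:ℝ) 1)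
    (b α₂ β₂ : ℝ) (hb : b = arcsinp p y₀)
    (hα₂ : α₂ = Real.log (b * (1 - y₀ ^ p) ^ (1 / p) / y₀) / b ^ p)
    (hβ₂ : β₂ = -1 / (p + 1)) :
    ∀ y ∈ Set.Ioo 0 y₀,
      Real.exp (α₂ * arcsinp p y ^ p) < arcsinp p y * (1 - y ^ p) ^ (1 / p) / y ∧
      arcsinp p y * (1 - y ^ p) ^ (1 / p) / y < Real.exp (β₂ * arcsinp p y ^ p) := by
  have hp0 : 0 < p := by linarith
  obtain ⟨hy₀0, hy₀1⟩ := hy₀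
  intro y ⟨hy0, hyy⟩
  have hy1 := hyy.trans hy₀1
  have hc : ∀ z : ℝ, 0 < z → z < 1 → 0 < 1 - z ^ p := fun z h0 h1 =>
    sub_pos.2 (rpow_lt_one h0.le h1 hp0)
  have hquot : ∀ z : ℝ, 0 < z → z < 1 → arcsinp p z * (1 - z ^ p) ^ (1 / p) / z =
      (z * (1 - z ^ p) ^ (-1 / p) / arcsinp p z)⁻¹ := by
    intro z h0 h1
    have := rpow_pos_of_pos (hc z h0 h1) (1 / p)
    rw [neg_div, rpow_neg (hc z h0 h1).le]
    field_simp
  obtain ⟨hmono, hbound⟩ := log_div_arctanp_properties hp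
  have htt : y * (1 - y ^ p) ^ (-1 / p) < y₀ * (1 - y₀ ^ p) ^ (-1 / p) := by
    have h1 : (1 - y ^ p) ^ (-1 / p) ≤ (1 - y₀ ^ p) ^ (-1 / p) := by
      refine rpow_le_rpow_of_nonpos (hc y₀ hy₀0 hy₀1) ?_
        (div_nonpos_of_nonpos_of_nonneg (by norm_num) hp0.le)
      linarith [rpow_lt_rpow hy0.le hyy hp0]
    exact mul_lt_mul hyy h1 (rpow_pos_of_pos (hc y hy0 hy1) _) hy₀0.le
  have ht : 0 < y * (1 - y ^ p) ^ (-1 / p) := mul_pos hy0 (rpow_pos_of_pos (hc y hy0 hy1) _)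
  have hlt := hmono ht (ht.trans htt) htt
  have hlb := hbound _ ht
  have hx := arctanp_pos hp0 ht
  rw [hb, hquot y₀ hy₀0 hy₀1, log_inv] at hα₂
  rw [hquot y hy0 hy1, hα₂, hβ₂]
  dsimp only at hlt
  rw [← arcsinp_eq_arctanp (by linarith) hy0.le hy1] at hlt hlb hx
  rw [← arcsinp_eq_arctanp (by linarith) hy₀0.le hy₀1] at hlt
  have hxp : 0 < arcsinp p y ^ p := rpow_pos_of_pos hx p
  have hq : 0 < (y * (1 - y ^ p) ^ (-1 / p) / arcsinp p y)⁻¹ := inv_pos.2 (div_pos ht hx)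
  rw [div_lt_iff₀ hxp] at hlt
  rw [lt_div_iff₀ hxp] at hlb
  constructor
  · rw [← lt_log_iff_exp_lt hq, log_inv, neg_div]
    linarith
  · rw [← log_lt_iff_lt_exp hq, log_inv, neg_div (p + 1)]
    linarith
end
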